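/- Let I ≥ 2, J ≥ 1, R ≥ 1 be integers, let T ∈ ℂ^{I×J} and F ∈ ℂ^{J×J} satisfy J₁T = J₂TF, let t_k ∈ ℂ^J denote the k-th column of Tᴴ, and suppose Q ∈ ℂ^{J×J} satisfies Q t_I = 0 and Q (Fᴴ t_1) = 0. Let ω_1,…,ω_R ∈ ℝ, let A ∈ ℂ^{I×R} have columns a^{(I)}(ω_r), let B = Tᴴ A ∈ ℂ^{J×R} be the beamspace array manifold, and let Φ = diag(exp(jω_1),…,exp(jω_R)). Then the restored shift-invariance relation Q B Φ = Q Fᴴ B holds. -/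

import Mathlib

open Matrix

/-- The vector `a^{(I)}(ω) ∈ ℂ^I` with `k`-th (0-indexed) entry `exp(j k ω)`. -/
noncomputable def aVec (I : ℕ) (ω : ℝ) : Fin I → ℂ :=
  fun k => Complex.exp (Complex.I * ((k : ℕ) : ℂ) * (ω : ℂ))

/-- The selection matrix `J₁ = [I_{I-1}, 0]` keeping the first `I-1` rows. -/
def selFirst (I : ℕ) : Matrix (Fin (I - 1)) (Fin I) ℂ :=
  fun k i => if (i : ℕ) = (k : ℕ) then 1 else 0

/-- The selection matrix `J₂ = [0, I_{I-1}]` keeping the last `I-1` rows. -/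
def selLast (I : ℕ) : Matrix (Fin (I - 1)) (Fin I) ℂ :=
  fun k i => if (i : ℕ) = (k : ℕ) + 1 then 1 else 0

theorem selFirst_mul_apply {n : ℕ} {m : Type*} (M : Matrix (Fin (n + 1)) m ℂ) (k : Fin n) (i : m) :
    (selFirst (n + 1) * M) k i = M k.castSucc i := by
  rw [Matrix.mul_apply, Finset.sum_eq_single k.castSucc]
  · simp [selFirst]
  · intro b _ hb
    have : (b : ℕ) ≠ k := fun h => hb (Fin.ext h)
    simp [selFirst, this]
  · simp

theorem selLast_mul_apply {n : ℕ} {m : Type*} (M : Matrix (Fin (n + 1)) m ℂ) (k : Fin n) (i : m) :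
    (selLast (n + 1) * M) k i = M k.succ i := by
  rw [Matrix.mul_apply, Finset.sum_eq_single k.succ]
  · simp [selLast]
  · intro b _ hb
    have : (b : ℕ) ≠ k + 1 := fun h => hb (Fin.ext h)
    simp [selLast, this]
  · simp

theorem aVec_castSucc_mul_exp {n : ℕ} (ω : ℝ) (k : Fin n) :
    aVec (n + 1) ω k.castSucc * Complex.exp (Complex.I * (ω : ℂ)) = aVec (n + 1) ω k.succ := by
  rw [aVec, aVec, ← Complex.exp_add]
  congr 1
  simp only [Fin.val_castSucc, Fin.val_succ]
  push_cast
  ring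

/-- Restored shift-invariance for beamspace ESPRIT, matrix form:
if `J₁ T = J₂ T F`, `Q t_I = 0` and `Q (Fᴴ t_1) = 0` (where `t_k` is the `k`-th
column of `Tᴴ`), and `B = Tᴴ A` is the beamspace manifold with `A` the
Vandermonde-type element-space manifold, then `Q B Φ = Q Fᴴ B`. -/
theorem stmt2 (I J R : ℕ) (hI : 2 ≤ I) (hJ : 1 ≤ J) (hR : 1 ≤ R)
    (T : Matrix (Fin I) (Fin J) ℂ) (F : Matrix (Fin J) (Fin J) ℂ)
    (hTF : selFirst I * T = selLast I * T * F)
    (Q : Matrix (Fin J) (Fin J) ℂ)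
    (hQ1 : Q.mulVec (fun i => star (T ⟨I - 1, by omega⟩ i)) = 0)
    (hQ2 : Q.mulVec (Fᴴ.mulVec (fun i => star (T ⟨0, by omega⟩ i))) = 0)
    (ω : Fin R → ℝ)
    (A : Matrix (Fin I) (Fin R) ℂ)
    (hA : ∀ (k : Fin I) (r : Fin R), A k r = aVec I (ω r) k)
    (B : Matrix (Fin J) (Fin R) ℂ) (hB : B = Tᴴ * A)
    (Φ : Matrix (Fin R) (Fin R) ℂ)
    (hΦ : Φ = Matrix.diagonal (fun r => Complex.exp (Complex.I * (ω r : ℂ)))) :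
    Q * B * Φ = Q * Fᴴ * B := by
  obtain ⟨n, rfl⟩ : ∃ n, I = n + 1 := ⟨I - 1, by omega⟩
  have hrow : ∀ (k : Fin n) (j : Fin J), T k.castSucc j = (T * F) k.succ j := by
    intro k j
    exact (selFirst_mul_apply T k j).symm.trans ((congrFun (congrFun hTF k) j).trans
      (by rw [Matrix.mul_assoc]; exact selLast_mul_apply (T * F) k j))
  have hshift : ∀ (i : Fin J) (k : Fin n),
      (Q * Tᴴ) i k.castSucc = (Q * Fᴴ * Tᴴ) i k.succ := by
    intro i k
    rw [Matrix.mul_assoc, ← Matrix.conjTranspose_mul, Matrix.mul_apply, Matrix.mul_apply]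
    simp only [Matrix.conjTranspose_apply, hrow]
  have hlast : ∀ i : Fin J, (Q * Tᴴ) i (Fin.last n) = 0 := fun i => congrFun hQ1 i
  have hfirst : ∀ i : Fin J, (Q * Fᴴ * Tᴴ) i 0 = 0 := by
    intro i
    rw [Matrix.mulVec_mulVec] at hQ2
    exact congrFun hQ2 i
  subst hB hΦ
  ext i r
  rw [Matrix.mul_diagonal, ← Matrix.mul_assoc, ← Matrix.mul_assoc, Matrix.mul_apply,
    Matrix.mul_apply, Fin.sum_univ_castSucc, Fin.sum_univ_succ, hlast, hfirst, zero_mul, zero_mul,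
    add_zero, zero_add, Finset.sum_mul]
  refine Finset.sum_congr rfl fun k _ => ?_
  rw [hshift, hA, hA, mul_assoc, aVec_castSucc_mul_exp]
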